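/- arXiv:2005.08888 — 2 statements merged into one kernel-verified Lean document; each statement's English description precedes it below -/
import Mathlib

section
/- For every m ≥ 2, the polynomials ca_n satisfy the recurrence ca_m(a,b) = (a+b)·ca_{m−1}(a,b) + a·b·Σ_{j=1}^{m−2} ca_j(a,b)·ca_{m−1−j}(a,b) in ℤ[a,b]. Equivalently, setting N_q(a,b) := ca_{q−1}(a,b) for q ≥ 2 and N_q = 1 for q ≤ 2, one has N_n = (a+b)·N_{n−1} + a·b·Σ_{k=2}^{n−2} N_k·N_{n−k} for all n ≥ 3. -/
open MvPolynomial

/-- Narayana number T(n,k) = (1/k)·C(n−1,k−1)·C(n,k−1). -/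
def narayana (n k : ℕ) : ℕ := ((n - 1).choose (k - 1) * n.choose (k - 1)) / k

/-- The polynomial ca_n(a,b) = Σ_{i=0}^{n−1} T(n,i+1)·a^i·b^{n−1−i} ∈ ℤ[a,b],
with a = X 0 and b = X 1. -/
noncomputable def caP (n : ℕ) : MvPolynomial (Fin 2) ℤ :=
  ∑ i ∈ Finset.range n, (narayana n (i + 1) : MvPolynomial (Fin 2) ℤ) * X 0 ^ i * X 1 ^ (n - 1 - i)

/-- N_q(a,b) := ca_{q−1}(a,b) for q ≥ 2 (wait: for q ≥ 3 it is ca_{q-1}; N_q = 1 for q ≤ 2,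
and indeed ca_1 = 1, so N_q = ca_{q-1} for q ≥ 2 and N_q = 1 for q ≤ 2 are consistent). -/
noncomputable def NP (q : ℕ) : MvPolynomial (Fin 2) ℤ := if q ≤ 2 then 1 else caP (q - 1)

theorem succ_dvd_choose_mul_choose (m i : ℕ) : i + 1 ∣ m.choose i * (m + 1).choose i := by
  have h₁ : ((i + 1 : ℕ) : ℤ) ∣ (m + 1) * (m.choose i * (m + 1).choose i) := by
    have h := congrArg (Nat.cast (R := ℤ)) (Nat.add_one_mul_choose_eq m i)
    push_cast at h
    exact ⟨(m + 1).choose (i + 1) * (m + 1).choose i, by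
      push_cast; linear_combination ((m + 1).choose i : ℤ) * h⟩
  have h₂ : ((i + 1 : ℕ) : ℤ) ∣ (m + 1 - i) * (m.choose i * (m + 1).choose i) := by
    rcases le_or_gt i (m + 1) with hi | hi
    · have h := congrArg (Nat.cast (R := ℤ)) (Nat.choose_succ_right_eq (m + 1) i)
      push_cast [Nat.cast_sub hi] at h
      exact ⟨(m + 1).choose (i + 1) * m.choose i, by
        push_cast; linear_combination -(m.choose i : ℤ) * h⟩
    · simp [Nat.choose_eq_zero_of_lt hi]
  have h₃ : ((i + 1 : ℕ) : ℤ) ∣ (i + 1) * (m.choose i * (m + 1).choose i) :=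
    ⟨m.choose i * (m + 1).choose i, by push_cast; ring⟩
  have h := (h₃.sub h₁).add h₂
  rw [show ((i + 1) * (m.choose i * (m + 1).choose i) - (m + 1) * (m.choose i * (m + 1).choose i)
    + (m + 1 - i) * (m.choose i * (m + 1).choose i) : ℤ)
      = ((m.choose i * (m + 1).choose i : ℕ) : ℤ) by push_cast; ring] at h
  exact_mod_cast h

theorem cast_narayana_succ (m i : ℕ) :
    (narayana (m + 1) (i + 1) : ℚ) = m.choose i * (m + 1).choose i / (i + 1) := by
  rw [narayana, Nat.add_sub_cancel, Nat.add_sub_cancel,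
    Nat.cast_div (succ_dvd_choose_mul_choose m i) (by positivity)]
  push_cast
  rfl

theorem cast_choose_succ_right (n k : ℕ) :
    (n.choose (k + 1) : ℚ) = n.choose k * (n - k) / (k + 1) := by
  rw [eq_div_iff (by positivity)]
  rcases le_or_gt k n with h | h
  · have := congrArg (Nat.cast (R := ℚ)) (Nat.choose_succ_right_eq n k)
    push_cast [Nat.cast_sub h] at this
    exact this
  · simp [Nat.choose_eq_zero_of_lt h, Nat.choose_eq_zero_of_lt (h.trans (Nat.lt_succ_self k))]

/-- The sequence `F` delayed by one step. -/
def delay {R : Type*} [Zero R] (F : ℕ → R) : ℕ → R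
  | 0 => 0
  | i + 1 => F i

/-- The coefficients of `caP (m + 1)`. -/
def narayanaRow (m i : ℕ) : ℤ := narayana (m + 1) (i + 1)

theorem narayanaRow_eq_zero {m i : ℕ} (h : m < i) : narayanaRow m i = 0 := by
  simp [narayanaRow, narayana, Nat.choose_eq_zero_of_lt h]

theorem narayanaRow_recurrence (m i : ℕ) :
    (m + 4) * narayanaRow (m + 2) i =
      (2 * m + 5) * (delay (narayanaRow (m + 1)) i + narayanaRow (m + 1) i)
      - (m + 1) * (delay (delay (narayanaRow m)) i - 2 * delay (narayanaRow m) i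
        + narayanaRow m i) := by
  rw [← Int.cast_inj (α := ℚ)]
  rcases i with _ | _ | _ | i <;>
    simp only [delay, narayanaRow] <;> push_cast <;>
    simp only [cast_narayana_succ, Nat.choose_succ_succ, Nat.choose_zero_right] <;>
    push_cast <;>
    (try simp only [cast_choose_succ_right, Nat.choose_zero_right]) <;>
    push_cast <;> field_simp <;> ring

/-- The binary form of degree `n - 1` with coefficients `F`. -/
noncomputable def binaryForm (n : ℕ) (F : ℕ → ℤ) : MvPolynomial (Fin 2) ℤ :=
  ∑ i ∈ Finset.range n, (F i : MvPolynomial (Fin 2) ℤ) * X 0 ^ i * X 1 ^ (n - 1 - i)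

theorem X_zero_mul_binaryForm (n : ℕ) (F : ℕ → ℤ) :
    X 0 * binaryForm n F = binaryForm (n + 1) (delay F) := by
  simp only [binaryForm, Finset.sum_range_succ', delay, Finset.mul_sum, Int.cast_zero, zero_mul,
    add_zero]
  refine Finset.sum_congr rfl fun i _ => ?_
  rw [show n + 1 - 1 - (i + 1) = n - 1 - i by omega]
  ring

theorem X_one_mul_binaryForm {n : ℕ} {F : ℕ → ℤ} (h : F n = 0) :
    X 1 * binaryForm n F = binaryForm (n + 1) F := by
  simp only [binaryForm, Finset.sum_range_succ, h, Finset.mul_sum, Int.cast_zero, zero_mul,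
    add_zero]
  refine Finset.sum_congr rfl fun i hi => ?_
  rw [show n + 1 - 1 - i = n - 1 - i + 1 by have := Finset.mem_range.mp hi; omega]
  ring

theorem caP_succ (m : ℕ) : caP (m + 1) = binaryForm (m + 1) (narayanaRow m) := by
  simp [caP, binaryForm, narayanaRow]

theorem caP_zero : caP 0 = 0 := by simp [caP]

theorem caP_one : caP 1 = 1 := by simp [caP, narayana]

theorem caP_two : caP 2 = X 0 + X 1 := by
  simp [caP, narayana, Finset.sum_range_succ, add_comm]

theorem caP_linear_recurrence (n : ℕ) :
    ((n : MvPolynomial (Fin 2) ℤ) + 3) * caP (n + 2) =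
      (2 * (n : MvPolynomial (Fin 2) ℤ) + 3) * (X 0 + X 1) * caP (n + 1)
        - (n : MvPolynomial (Fin 2) ℤ) * (X 0 - X 1) ^ 2 * caP n := by
  rcases n with _ | m
  · rw [caP_zero, caP_one, caP_two]
    push_cast
    ring
  have h₀ : ∀ i, narayanaRow i (i + 1) = 0 := fun i => narayanaRow_eq_zero i.lt_succ_self
  have a₁ := X_zero_mul_binaryForm (m + 2) (narayanaRow (m + 1))
  have b₁ := X_one_mul_binaryForm (h₀ (m + 1))
  have a₀ := X_zero_mul_binaryForm (m + 1) (narayanaRow m)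
  have b₀ := X_one_mul_binaryForm (h₀ m)
  have aa := X_zero_mul_binaryForm (m + 2) (delay (narayanaRow m))
  have ab := X_zero_mul_binaryForm (m + 2) (narayanaRow m)
  have bb := X_one_mul_binaryForm (n := m + 2) (narayanaRow_eq_zero (m := m) (by omega))
  have key : ((m : MvPolynomial (Fin 2) ℤ) + 4) * binaryForm (m + 3) (narayanaRow (m + 2)) =
      (2 * (m : MvPolynomial (Fin 2) ℤ) + 5) * (binaryForm (m + 3) (delay (narayanaRow (m + 1)))
        + binaryForm (m + 3) (narayanaRow (m + 1)))
      - (m + 1) * (binaryForm (m + 3) (delay (delay (narayanaRow m)))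
        - 2 * binaryForm (m + 3) (delay (narayanaRow m)) + binaryForm (m + 3) (narayanaRow m)) := by
    simp only [binaryForm, Finset.mul_sum, ← Finset.sum_add_distrib, ← Finset.sum_sub_distrib]
    refine Finset.sum_congr rfl fun i _ => ?_
    have h := congrArg (Int.cast (R := MvPolynomial (Fin 2) ℤ)) (narayanaRow_recurrence m i)
    push_cast at h
    linear_combination X 0 ^ i * X 1 ^ (m + 3 - 1 - i) * h
  rw [← a₁, ← b₁, ← aa, ← ab, ← bb, ← a₀, ← b₀] at key
  rw [caP_succ, caP_succ, caP_succ]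
  push_cast
  linear_combination key

open PowerSeries in
theorem PowerSeries.eq_zero_of_derivative_mul_eq {R : Type*} [CommRing R] [IsAddTorsionFree R]
    {D E : PowerSeries R} (hD : constantCoeff D = 1) (hE : constantCoeff E = 0)
    (h : derivative R E * D = E * derivative R D) : E = 0 := by
  have hV : D * invOfUnit D 1 = 1 := mul_invOfUnit D 1 hD
  set V := invOfUnit D 1
  have hV' : D * derivative R V + V * derivative R D = 0 := by
    simpa using congrArg (derivative R) hV
  have hEV : E * V = 0 := by
    refine derivative.ext ?_ (by simp [hE])
    simp only [Derivation.leibniz, smul_eq_mul, map_zero]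
    linear_combination V ^ 2 * h + E * V * hV' - (V * derivative R E + E * derivative R V) * hV
  linear_combination D * hEV - E * hV

/-- The generating function `∑ ca_n xⁿ`. -/
noncomputable def caSeries : PowerSeries (MvPolynomial (Fin 2) ℤ) := PowerSeries.mk caP

theorem caSeries_differential_equation :
    (1 - 2 * PowerSeries.C (X 0 + X 1) * PowerSeries.X + PowerSeries.C ((X 0 - X 1) ^ 2) * PowerSeries.X ^ 2)
        * PowerSeries.derivative _ (PowerSeries.X * caSeries) =
      2 * PowerSeries.X + (PowerSeries.C ((X 0 - X 1) ^ 2) * PowerSeries.X - PowerSeries.C (X 0 + X 1))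
        * (PowerSeries.X * caSeries) := by
  set s : MvPolynomial (Fin 2) ℤ := X 0 + X 1
  set d : MvPolynomial (Fin 2) ℤ := (X 0 - X 1) ^ 2
  set U := PowerSeries.X * caSeries
  suffices h : PowerSeries.derivative _ U + PowerSeries.C d * (PowerSeries.X * (PowerSeries.X * PowerSeries.derivative _ U))
      + PowerSeries.C s * U = PowerSeries.C 2 * PowerSeries.X + PowerSeries.C d * (PowerSeries.X * U)
        + PowerSeries.C (2 * s) * (PowerSeries.X * PowerSeries.derivative _ U) by
    have h2 : (PowerSeries.C (2 : MvPolynomial (Fin 2) ℤ)) = 2 := map_ofNat PowerSeries.C 2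
    rw [map_mul PowerSeries.C, h2] at h
    linear_combination h
  have hU : ∀ n, PowerSeries.coeff (n + 1) U = caP n := fun n => by
    simp [U, caSeries, PowerSeries.coeff_succ_X_mul]
  have hU0 : PowerSeries.coeff 0 U = 0 := by simp [U]
  ext1 k
  rcases k with _ | _ | k
  · have h0 : PowerSeries.constantCoeff caSeries = 0 := by
      rw [← PowerSeries.coeff_zero_eq_constantCoeff_apply, caSeries, PowerSeries.coeff_mk, caP_zero]
    simp [U, h0]
  · simp only [map_add, PowerSeries.coeff_C_mul, PowerSeries.coeff_succ_X_mul, PowerSeries.coeff_derivative, hU, hU0, PowerSeries.coeff_zero_X_mul,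
      zero_add, PowerSeries.coeff_one_X, caP_zero, caP_one]
    simp
    norm_num
  · simp only [map_add, PowerSeries.coeff_C_mul, PowerSeries.coeff_succ_X_mul, PowerSeries.coeff_derivative, hU, PowerSeries.coeff_X]
    have := caP_linear_recurrence k
    push_cast
    simp
    linear_combination this

theorem caSeries_functional_equation :
    caSeries = PowerSeries.X + PowerSeries.C (X 0 + X 1) * (PowerSeries.X * caSeries)
      + PowerSeries.C (X 0 * X 1) * (PowerSeries.X * (caSeries * caSeries)) := by
  have ode := caSeries_differential_equation
  set a : PowerSeries (MvPolynomial (Fin 2) ℤ) := PowerSeries.C (X 0) with ha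
  set b : PowerSeries (MvPolynomial (Fin 2) ℤ) := PowerSeries.C (X 1) with hb
  have ha' : PowerSeries.derivative (MvPolynomial (Fin 2) ℤ) a = 0 := PowerSeries.derivative_C
  have hb' : PowerSeries.derivative (MvPolynomial (Fin 2) ℤ) b = 0 := PowerSeries.derivative_C
  simp only [map_add, map_sub, map_pow, map_mul, ← ha, ← hb] at ode ⊢
  set U := PowerSeries.X * caSeries
  set x : PowerSeries (MvPolynomial (Fin 2) ℤ) := PowerSeries.X
  have hx' : PowerSeries.derivative (MvPolynomial (Fin 2) ℤ) x = 1 := PowerSeries.derivative_X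
  have h2' : PowerSeries.derivative (MvPolynomial (Fin 2) ℤ) (2 : PowerSeries _) = 0 :=
    (PowerSeries.derivative _).map_natCast 2
  have hS : (1 - (a + b) * x - 2 * a * b * U) ^ 2
      - (1 - 2 * (a + b) * x + (a - b) ^ 2 * x ^ 2) = 0 := by
    refine PowerSeries.eq_zero_of_derivative_mul_eq (D := 1 - 2 * (a + b) * x + (a - b) ^ 2 * x ^ 2)
      (by simp [x]) (by simp [x, U]) ?_
    simp only [pow_two, map_sub, map_add, Derivation.leibniz, smul_eq_mul, ha', hb', hx', h2',
      Derivation.map_one_eq_zero]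
    linear_combination (-4 * a * b) * (1 - (a + b) * x - 2 * a * b * U) * ode
  have ha0 : a ≠ 0 := (map_ne_zero_iff _ PowerSeries.C_injective).mpr (X_ne_zero 0)
  have hb0 : b ≠ 0 := (map_ne_zero_iff _ PowerSeries.C_injective).mpr (X_ne_zero 1)
  have hx0 : x ≠ 0 := PowerSeries.X_ne_zero
  have h4 : (4 : PowerSeries (MvPolynomial (Fin 2) ℤ)) ≠ 0 := by
    rw [← map_ofNat PowerSeries.C 4, ← map_ofNat MvPolynomial.C 4]
    exact (map_ne_zero_iff _ PowerSeries.C_injective).mpr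
      ((map_ne_zero_iff _ (MvPolynomial.C_injective _ _)).mpr four_ne_zero)
  refine mul_left_cancel₀ (mul_ne_zero (mul_ne_zero (mul_ne_zero h4 ha0) hb0) hx0) ?_
  simp only [U] at hS ⊢
  linear_combination -hS

theorem caP_quadratic_recurrence (k : ℕ) :
    caP (k + 2) = (X 0 + X 1) * caP (k + 1)
      + X 0 * X 1 * ∑ j ∈ Finset.Icc 1 k, caP j * caP (k + 1 - j) := by
  have h := congrArg (PowerSeries.coeff (k + 2)) caSeries_functional_equation
  rw [map_add, map_add, PowerSeries.coeff_C_mul, PowerSeries.coeff_C_mul,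
    PowerSeries.coeff_succ_X_mul, PowerSeries.coeff_succ_X_mul, PowerSeries.coeff_mul,
    PowerSeries.coeff_X, if_neg (by omega), zero_add] at h
  simp only [caSeries, PowerSeries.coeff_mk] at h
  rw [Finset.Nat.sum_antidiagonal_eq_sum_range_succ (fun i j => caP i * caP j),
    Finset.sum_range_succ, Finset.sum_range_succ'] at h
  rw [h, ← Finset.Ico_succ_right_eq_Icc, Finset.sum_Ico_eq_sum_range]
  simp [caP_zero, add_comm]

theorem stmt1 :
    (∀ m : ℕ, 2 ≤ m →
      caP m = (X 0 + X 1) * caP (m - 1)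
        + X 0 * X 1 * ∑ j ∈ Finset.Icc 1 (m - 2), caP j * caP (m - 1 - j)) ∧
    (∀ n : ℕ, 3 ≤ n →
      NP n = (X 0 + X 1) * NP (n - 1)
        + X 0 * X 1 * ∑ k ∈ Finset.Icc 2 (n - 2), NP k * NP (n - k)) := by
  refine ⟨fun m hm => ?_, fun n hn => ?_⟩
  · obtain ⟨k, rfl⟩ := Nat.exists_eq_add_of_le' hm
    exact caP_quadratic_recurrence k
  · obtain ⟨k, rfl⟩ := Nat.exists_eq_add_of_le' hn
    have hNP : ∀ j, NP (j + 2) = caP (j + 1) := fun j => by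
      rcases j with _ | j
      · simp [NP, caP_one]
      · simp [NP]
    have hsum : ∑ j ∈ Finset.Icc 1 k, caP j * caP (k + 1 - j)
        = ∑ j ∈ Finset.Icc 2 (k + 3 - 2), NP j * NP (k + 3 - j) := by
      refine Finset.sum_bij (fun j _ => j + 1) ?_ (by simp) ?_ ?_
      · intro j hj
        simp only [Finset.mem_Icc] at hj ⊢
        omega
      · intro j hj
        simp only [Finset.mem_Icc] at hj
        exact ⟨j - 1, by simp only [Finset.mem_Icc]; omega, by omega⟩
      · intro j hj
        simp only [Finset.mem_Icc] at hj
        obtain ⟨i, rfl⟩ := Nat.exists_eq_add_of_le' hj.1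
        obtain ⟨l, rfl⟩ := Nat.exists_eq_add_of_le' hj.2
        rw [hNP, show l + (i + 1) + 3 - (i + 1 + 1) = l + 2 by omega, hNP,
          show l + (i + 1) + 1 - (i + 1) = l + 1 by omega]
    rw [← hsum, show k + 3 - 1 = k + 2 by omega, hNP k, show NP (k + 3) = caP (k + 2) from hNP (k + 1)]
    exact caP_quadratic_recurrence k
end

section
/- Let n ≥ 2 and σ ∈ S_n, and let 1 = i_0 < i_1 < ⋯ < i_p < i_{p+1} = n be the maximal runs of σ, i.e., the unique such sequence with σ monotone (increasing or decreasing) on each interval {i_k, i_k+1, …, i_{k+1}} for 0 ≤ k ≤ p and not monotone on {i_k, …, i_{k+2}} for 0 ≤ k ≤ p−1. For 0 ≤ k ≤ p set m_k = a if σ is increasing on {i_k,…,i_{k+1}} and m_k = b if σ is decreasing there. Then c_σ = (−1)^{des(σ)} · (Π_{k=0}^{p−1} m_k) · (Π_{k=0}^{p} N_{i_{k+1}−i_k+1}(a,b)), where N_q(a,b) := ca_{q−1}(a,b) for q ≥ 2. -/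
open MvPolynomial

/-- The standardization of a word with distinct letters: each letter is replaced by its rank. -/
def stdW (w : List ℕ) : List ℕ := w.map fun x => (w.filter (· ≤ x)).length

/-- a_k = a for k ≥ 2, a_1 = 1. -/
noncomputable def aW (k : ℕ) : MvPolynomial (Fin 2) ℤ := if 2 ≤ k then X 0 else 1

/-- b_k = b for k ≥ 2, b_1 = 1. -/
noncomputable def bW (k : ℕ) : MvPolynomial (Fin 2) ℤ := if 2 ≤ k then X 1 else 1

/-- Fuel-based auxiliary for the recursive definition of c_σ on words. -/
noncomputable def cAux : ℕ → List ℕ → MvPolynomial (Fin 2) ℤ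
  | 0, _ => 1
  | f + 1, w =>
    if w.length ≤ 1 then 1
    else
      (∑ k ∈ Finset.Ioo 0 w.length,
        if 1 ∈ w.take k ∧ w.length ∈ w.drop k then
          bW k * aW (w.length - k) * cAux f (stdW (w.take k)) * cAux f (stdW (w.drop k))
        else 0)
      -
      (∑ k ∈ Finset.Ioo 0 w.length,
        if w.length ∈ w.take k ∧ 1 ∈ w.drop k then
          aW k * bW (w.length - k) * cAux f (stdW (w.take k)) * cAux f (stdW (w.drop k))
        else 0)

/-- The polynomial c_σ ∈ ℤ[a,b] of a permutation word σ (a word on {1,…,n}). -/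
noncomputable def cpol (w : List ℕ) : MvPolynomial (Fin 2) ℤ := cAux w.length w

/-- The word σ(1)σ(2)⋯σ(n) ∈ {1,…,n}ⁿ of a permutation σ ∈ S_n. -/
def permWord {n : ℕ} (σ : Equiv.Perm (Fin n)) : List ℕ := List.ofFn fun i => (σ i : ℕ) + 1

/-- The descent set Des(w) = {i ∈ {1,…,|w|−1} : w(i) > w(i+1)} of a word (positions 1-based). -/
def desSet (w : List ℕ) : Finset ℕ :=
  (Finset.Icc 1 (w.length - 1)).filter fun i => w.getD i 0 < w.getD (i - 1) 0

/-- The letter of the word `w` at (1-based) position `j`. -/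
def get1 (w : List ℕ) (j : ℕ) : ℕ := w.getD (j - 1) 0

/-- `w` is increasing on the interval of positions {l, l+1, …, r}. -/
def incOn (w : List ℕ) (l r : ℕ) : Prop := ∀ j, l ≤ j → j < r → get1 w j < get1 w (j + 1)

/-- `w` is decreasing on the interval of positions {l, l+1, …, r}. -/
def decOn (w : List ℕ) (l r : ℕ) : Prop := ∀ j, l ≤ j → j < r → get1 w (j + 1) < get1 w j

/-- `w` is monotone on the interval of positions {l, l+1, …, r}. -/
def monoOn (w : List ℕ) (l r : ℕ) : Prop := incOn w l r ∨ decOn w l r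

/-- Narayana numbers are integral: `k + 1` divides `C(n,k)·C(n+1,k)`. -/
lemma succ_dvd_choose_mul_choose_s4 (n k : ℕ) : (k + 1) ∣ n.choose k * (n + 1).choose k := by
  rcases Nat.eq_zero_or_pos k with rfl | hk
  · simp
  have h : k * (n.choose k * (n + 1).choose k) =
      (k + 1) * (n.choose (k - 1) * (n + 1).choose (k + 1)) := by
    rcases k with _ | k
    · omega
    · have h1 := Nat.choose_succ_right_eq n k
      have h2 := Nat.choose_succ_right_eq (n + 1) (k + 1)
      rw [show n + 1 - (k + 1) = n - k by omega] at h2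
      calc (k + 1) * (n.choose (k + 1) * (n + 1).choose (k + 1))
          = (n.choose (k + 1) * (k + 1)) * (n + 1).choose (k + 1) := by ring
        _ = n.choose k * ((n + 1).choose (k + 1) * (n - k)) := by rw [h1]; ring
        _ = (k + 1 + 1) * (n.choose (k + 1 - 1) * (n + 1).choose (k + 1 + 1)) := by
            rw [← h2, Nat.add_sub_cancel]; ring
  exact (Nat.coprime_self_add_left.2 (Nat.coprime_one_left k)).dvd_of_dvd_mul_left ⟨_, h⟩

lemma mul_narayana (n i : ℕ) (hi : i ≤ n) :
    (n + 1) * narayana (n + 1) (i + 1) = (n + 1).choose i * (n + 1).choose (n - i) := by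
  have h := Nat.div_mul_cancel (succ_dvd_choose_mul_choose_s4 n i)
  have hs : (n + 1).choose (n - i) = (n + 1).choose (i + 1) :=
    (Nat.choose_symm_of_eq_add (by omega)).symm
  have h1 := Nat.add_one_mul_choose_eq n i
  simp only [narayana, Nat.add_sub_cancel, hs]
  apply Nat.eq_of_mul_eq_mul_right (Nat.succ_pos i)
  rw [mul_assoc, Nat.succ_eq_add_one, h, mul_assoc, ← h1]
  ring

section Lagrange

variable {R : Type*} [CommRing R]

/-- The coefficients of the power series `y` with `y = x(1 + ay)(1 + by)`. -/
def quadCoeff (a b : R) : ℕ → R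
  | 0 => 0
  | n + 1 => ∑ j : Fin (n + 1),
      (if (j : ℕ) = 0 then 1 else a * quadCoeff a b j) *
        (if n - (j : ℕ) = 0 then 1 else b * quadCoeff a b (n - j))

lemma mk_quadCoeff_eq (a b : R) :
    PowerSeries.mk (quadCoeff a b) = PowerSeries.X *
      ((1 + PowerSeries.C a * PowerSeries.mk (quadCoeff a b)) *
        (1 + PowerSeries.C b * PowerSeries.mk (quadCoeff a b))) := by
  ext n
  rcases n with _ | n
  · simp [quadCoeff]
  · rw [PowerSeries.coeff_succ_X_mul, PowerSeries.coeff_mk, quadCoeff, PowerSeries.coeff_mul,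
      Finset.Nat.sum_antidiagonal_eq_sum_range_succ_mk, Finset.sum_range]
    refine Finset.sum_congr rfl fun j _ => ?_
    congr 1
    all_goals
      simp only [map_add, PowerSeries.coeff_one, PowerSeries.coeff_C_mul, PowerSeries.coeff_mk]
      split_ifs with h
      · simp [h, quadCoeff]
      · simp

/-- Lagrange inversion for `y = xz` with `z = (1 + axz)(1 + bxz)`. -/
lemma lagrange_inversion_quadratic [IsDomain R] [CharZero R] (a b : R) (z : PowerSeries R)
    (hz : z = (1 + PowerSeries.C a * (PowerSeries.X * z)) *
      (1 + PowerSeries.C b * (PowerSeries.X * z)))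
    (N k d : ℕ) (h : k + d = N) :
    (N : R) * PowerSeries.coeff d (z ^ k) =
      k * (((1 + Polynomial.C a * Polynomial.X) * (1 + Polynomial.C b * Polynomial.X)) ^ N :
        Polynomial R).coeff d := by
  induction N generalizing k d with
  | zero =>
    obtain ⟨rfl, rfl⟩ : k = 0 ∧ d = 0 := by omega
    simp
  | succ N ih =>
    rcases k with _ | k
    · rw [pow_zero, PowerSeries.coeff_one, if_neg (by omega)]
      simp
    set ψ := (((1 + Polynomial.C a * Polynomial.X) * (1 + Polynomial.C b * Polynomial.X)) ^ N :
        Polynomial R) with hψ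
    have hX : (N : R) * PowerSeries.coeff d (PowerSeries.X * z ^ (k + 1)) =
        (k + 1 : R) * (Polynomial.X * ψ).coeff d := by
      rcases d with _ | d
      · simp
      · rw [PowerSeries.coeff_succ_X_mul, Polynomial.coeff_X_mul, ih (k + 1) d (by omega)]
        push_cast; rfl
    have hXX : (N : R) * PowerSeries.coeff d (PowerSeries.X * (PowerSeries.X * z ^ (k + 2))) =
        (k + 2 : R) * (Polynomial.X * (Polynomial.X * ψ)).coeff d := by
      rcases d with _ | _ | d
      · simp
      · simp [PowerSeries.coeff_succ_X_mul, Polynomial.coeff_X_mul]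
      · rw [PowerSeries.coeff_succ_X_mul, PowerSeries.coeff_succ_X_mul, Polynomial.coeff_X_mul,
          Polynomial.coeff_X_mul, ih (k + 2) d (by omega)]
        push_cast; rfl
    have hrec : z ^ (k + 1) = z ^ k + PowerSeries.C (a + b) * (PowerSeries.X * z ^ (k + 1)) +
        PowerSeries.C (a * b) * (PowerSeries.X * (PowerSeries.X * z ^ (k + 2))) := by
      rw [map_add, map_mul]
      linear_combination z ^ k * hz
    have hφ : ((1 + Polynomial.C a * Polynomial.X) * (1 + Polynomial.C b * Polynomial.X)) ^ (N + 1)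
        = ψ + Polynomial.C (a + b) * (Polynomial.X * ψ) +
          Polynomial.C (a * b) * (Polynomial.X * (Polynomial.X * ψ)) := by
      rw [map_add, map_mul, hψ]
      ring
    have hder : Polynomial.X * Polynomial.derivative
        (((1 + Polynomial.C a * Polynomial.X) * (1 + Polynomial.C b * Polynomial.X)) ^ (N + 1)) =
        Polynomial.C ((N : R) + 1) * (Polynomial.C (a + b) * (Polynomial.X * ψ) +
          Polynomial.C (2 * (a * b)) * (Polynomial.X * (Polynomial.X * ψ))) := by
      rw [Polynomial.derivative_pow_succ, ← hψ]
      simp only [Polynomial.derivative_mul, Polynomial.derivative_one,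
        Polynomial.derivative_C, Polynomial.derivative_X, map_add, map_mul, map_natCast, map_one,
        map_ofNat]
      ring
    have hcoeff : (d : R) * (((1 + Polynomial.C a * Polynomial.X) *
          (1 + Polynomial.C b * Polynomial.X)) ^ (N + 1) : Polynomial R).coeff d =
        (N + 1) * ((a + b) * (Polynomial.X * ψ).coeff d +
          2 * (a * b) * (Polynomial.X * (Polynomial.X * ψ)).coeff d) := by
      have := congrArg (fun q => Polynomial.coeff q d) hder
      simp only [Polynomial.coeff_C_mul, Polynomial.coeff_add] at this
      rw [← this]
      rcases d with _ | d
      · simp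
      · rw [Polynomial.coeff_X_mul, Polynomial.coeff_derivative]
        push_cast; ring
    rcases Nat.eq_zero_or_pos N with rfl | hN
    · obtain ⟨rfl, rfl⟩ : k = 0 ∧ d = 0 := by omega
      have : PowerSeries.constantCoeff z = 1 := by
        rw [hz]; simp
      simp [this, Polynomial.mul_coeff_zero]
    have hN' : (N : R) ≠ 0 := by exact_mod_cast hN.ne'
    apply mul_left_cancel₀ hN'
    have h0 := ih k d (by omega)
    have hc := congrArg (PowerSeries.coeff d) hrec
    rw [map_add (PowerSeries.coeff d), map_add (PowerSeries.coeff d), PowerSeries.coeff_C_mul,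
      PowerSeries.coeff_C_mul] at hc
    have hp := congrArg (fun q => Polynomial.coeff q d) hφ
    simp only [Polynomial.coeff_add, Polynomial.coeff_C_mul] at hp
    have hNk : (N : R) = k + d := by
      have : N = k + d := by omega
      exact_mod_cast this
    rw [hp] at hcoeff ⊢
    rw [hc]
    push_cast
    linear_combination (N + 1 : R) * (h0 + (a + b) * hX + a * b * hXX) - hcoeff +
      (ψ.coeff d + (a + b) * (Polynomial.X * ψ).coeff d +
          (a * b) * (Polynomial.X * (Polynomial.X * ψ)).coeff d) * (-hNk)

lemma coeff_one_add_C_mul_X_pow (a : R) (n k : ℕ) :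
    ((1 + Polynomial.C a * Polynomial.X) ^ n : Polynomial R).coeff k = a ^ k * n.choose k := by
  have : (1 + Polynomial.C a * Polynomial.X : Polynomial R) =
      (1 + Polynomial.X : Polynomial R).comp (Polynomial.C a * Polynomial.X) := by simp
  rw [this, ← Polynomial.pow_comp, Polynomial.comp_C_mul_X_coeff, Polynomial.coeff_one_add_X_pow,
    mul_comm]

end Lagrange

lemma caP_eq_quadCoeff (n : ℕ) :
    caP n = quadCoeff (X 0 : MvPolynomial (Fin 2) ℤ) (X 1) n := by
  rcases n with _ | n
  · simp [caP, quadCoeff]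
  set y := PowerSeries.mk (quadCoeff (X 0 : MvPolynomial (Fin 2) ℤ) (X 1)) with hy
  set z := (1 + PowerSeries.C (X 0) * y) * (1 + PowerSeries.C (X 1) * y) with hz
  have hyz : y = PowerSeries.X * z := mk_quadCoeff_eq _ _
  have h := lagrange_inversion_quadratic (X 0 : MvPolynomial (Fin 2) ℤ) (X 1) z
    (by rw [← hyz]) (n + 1) 1 n (by omega)
  have hn : ((n + 1 : ℕ) : MvPolynomial (Fin 2) ℤ) ≠ 0 := by exact_mod_cast Nat.succ_ne_zero n
  apply mul_left_cancel₀ hn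
  have hq : quadCoeff (X 0 : MvPolynomial (Fin 2) ℤ) (X 1) (n + 1) =
      PowerSeries.coeff n (z ^ 1) := by
    rw [pow_one, ← PowerSeries.coeff_succ_X_mul, ← hyz, hy, PowerSeries.coeff_mk]
  rw [hq, h, mul_pow, Polynomial.coeff_mul, Finset.Nat.sum_antidiagonal_eq_sum_range_succ_mk, caP,
    Finset.mul_sum, Nat.cast_one, one_mul]
  refine Finset.sum_congr rfl fun i hi => ?_
  have hm := mul_narayana n i (Nat.lt_succ_iff.1 (Finset.mem_range.1 hi))
  have hm' := congrArg (Nat.cast : ℕ → MvPolynomial (Fin 2) ℤ) hm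
  rw [Nat.cast_mul, Nat.cast_mul] at hm'
  rw [coeff_one_add_C_mul_X_pow, coeff_one_add_C_mul_X_pow, Nat.add_sub_cancel]
  linear_combination X 0 ^ i * X 1 ^ (n - i) * hm'

section RunWeight

variable {R : Type*} [CommRing R] (m : Bool → R) (L : ℕ → R)

/-- The run weight of a word of ascents (`true`) and descents (`false`) that is preceded by `l`
further letters `d`: the product of `L` over the lengths of the maximal runs, times the product of
`m` over the directions of all runs but the last. -/
def runWeightFrom : Bool → ℕ → List Bool → R
  | _, l, [] => L l
  | d, l, e :: r => if e = d then runWeightFrom d (l + 1) r else m d * L l * runWeightFrom e 1 r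

/-- The product of `L` over the lengths of the maximal runs, times the product of `m` over the
directions of all runs but the last. -/
def runWeight : List Bool → R
  | [] => 1
  | e :: r => runWeightFrom m L e 1 r

/-- `m d` for nonempty words, `1` for the empty word. -/
def endWeight (d : Bool) (α : List Bool) : R := if α = [] then 1 else m d

/-- `m d * L j` for `j ≥ 1`, and `1` for `j = 0`. -/
def pieceWeight (d : Bool) (j : ℕ) : R := if j = 0 then 1 else m d * L j

lemma runWeightFrom_append (α β : List Bool) (d e : Bool) (l : ℕ) (h : α.getLast?.getD e ≠ d) :
    runWeightFrom m L e l (α ++ d :: β) =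
      m (α.getLast?.getD e) * runWeightFrom m L e l α * runWeightFrom m L d 1 β := by
  induction α generalizing e l with
  | nil =>
    simp only [List.getLast?_nil, Option.getD_none] at h
    simp [runWeightFrom, h.symm]
  | cons x α ih =>
    rw [List.getLast?_cons, Option.getD_some] at h ⊢
    by_cases hx : x = e
    · subst hx
      simp only [List.cons_append, runWeightFrom, if_true]
      exact ih x (l + 1) h
    · simp only [List.cons_append, runWeightFrom, if_neg hx]
      rw [ih x 1 h]
      ring

lemma runWeightFrom_replicate (β : List Bool) (d : Bool) (l k : ℕ) (h : β.head? ≠ some d) :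
    runWeightFrom m L d l (List.replicate k d ++ β) =
      L (l + k) * (endWeight m d β * runWeight m L β) := by
  induction k generalizing l with
  | zero =>
    rcases β with _ | ⟨e, β⟩
    · simp [runWeightFrom, endWeight, runWeight]
    · have : e ≠ d := by simpa using h
      simp [runWeightFrom, endWeight, runWeight, this]
      ring
  | succ k ih =>
    rw [List.replicate_succ, List.cons_append, runWeightFrom, if_pos rfl, ih]
    congr 2
    omega

lemma runWeight_replicate (β : List Bool) (d : Bool) (k : ℕ) (h : β.head? ≠ some d) :
    runWeight m L (List.replicate (k + 1) d ++ β) =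
      L (k + 1) * (endWeight m d β * runWeight m L β) := by
  rw [List.replicate_succ, List.cons_append, runWeight, runWeightFrom_replicate m L β d 1 k h,
    add_comm]

lemma runWeight_append_replicate (α β : List Bool) (d : Bool) (k : ℕ)
    (hα : α.getLast? ≠ some d) (hβ : β.head? ≠ some d) :
    runWeight m L (α ++ List.replicate (k + 1) d ++ β) =
      (endWeight m (!d) α * runWeight m L α) * L (k + 1) *
        (endWeight m d β * runWeight m L β) := by
  rcases α with _ | ⟨e, α⟩
  · rw [List.nil_append, runWeight_replicate m L β d k hβ]
    simp [endWeight, runWeight]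
  · rw [List.getLast?_cons] at hα
    have hne : α.getLast?.getD e ≠ d := fun h => hα (by rw [h])
    have hd : α.getLast?.getD e = !d := by
      revert hne; cases α.getLast?.getD e <;> cases d <;> simp
    rw [List.replicate_succ, List.append_assoc, List.cons_append, List.cons_append, runWeight,
      runWeightFrom_append m L α _ d e 1 hne, runWeightFrom_replicate m L β d 1 k hβ, hd,
      add_comm 1 k]
    simp only [endWeight, runWeight, reduceCtorEq, if_false]
    ring

/-- The contribution of a cut with left part `u` and right part `v`. -/
def cutWeight (d : Bool) (u v : List Bool) : R :=
  endWeight m (!d) u * runWeight m L u * (endWeight m d v * runWeight m L v)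

/-- The signed sum of the contributions of all cuts of `α ++ γ ++ β` at a letter of `γ`. -/
def cutSum (d : Bool) : List Bool → List Bool → List Bool → R
  | _, [], _ => 0
  | α, x :: γ, β =>
    (if x = d then 1 else -1) * cutWeight m L d α (γ ++ β) + cutSum d (α ++ [x]) γ β

lemma cutSum_append (d : Bool) (α γ δ β : List Bool) :
    cutSum m L d α (γ ++ δ) β = cutSum m L d α γ (δ ++ β) + cutSum m L d (α ++ γ) δ β := by
  induction γ generalizing α with
  | nil => simp [cutSum]
  | cons x γ ih => simp [cutSum, ih, add_assoc]

lemma cutSum_replicate (d x : Bool) (α β : List Bool) (l : ℕ) :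
    cutSum m L d α (List.replicate (l + 1) x) β = (if x = d then 1 else -1) *
      ∑ j ∈ Finset.range (l + 1),
        cutWeight m L d (α ++ List.replicate j x) (List.replicate (l - j) x ++ β) := by
  induction l generalizing α with
  | zero => simp [cutSum]
  | succ l ih =>
    rw [List.replicate_succ, cutSum, ih, Finset.sum_range_succ' _ (l + 1), mul_add, add_comm]
    simp [List.replicate_succ]

lemma endWeight_mul_runWeight_left (α : List Bool) (d : Bool) (j : ℕ)
    (hα : α.getLast? ≠ some d) :
    endWeight m (!d) (α ++ List.replicate j d) * runWeight m L (α ++ List.replicate j d) =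
      endWeight m (!d) α * runWeight m L α * pieceWeight m L (!d) j := by
  rcases j with _ | j
  · simp [pieceWeight]
  · have := runWeight_append_replicate m L α [] d j hα (by simp)
    rw [List.append_nil] at this
    rw [this]
    simp [endWeight, runWeight, pieceWeight]
    ring_nf

lemma endWeight_mul_runWeight_right (β : List Bool) (d : Bool) (j : ℕ)
    (hβ : β.head? ≠ some d) :
    endWeight m d (List.replicate j d ++ β) * runWeight m L (List.replicate j d ++ β) =
      pieceWeight m L d j * (endWeight m d β * runWeight m L β) := by
  rcases j with _ | j
  · simp [pieceWeight]
  · rw [runWeight_replicate m L β d j hβ]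
    simp [endWeight, pieceWeight]
    ring_nf

lemma exists_replicate_append (d : Bool) (γ : List Bool) :
    ∃ k δ, γ = List.replicate k d ++ δ ∧ δ.head? ≠ some d := by
  induction γ with
  | nil => exact ⟨0, [], by simp⟩
  | cons x γ ih =>
    by_cases hx : x = d
    · obtain ⟨k, δ, h, h'⟩ := ih
      exact ⟨k + 1, δ, by simp [hx, h, List.replicate_succ], h'⟩
    · exact ⟨0, x :: γ, by simp [hx]⟩

variable (hL : ∀ d n, L (n + 1) =
  ∑ j ∈ Finset.range (n + 1), pieceWeight m L (!d) j * pieceWeight m L d (n - j))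

include hL

lemma cutSum_run (d : Bool) (α β : List Bool) (l : ℕ)
    (hα : α.getLast? ≠ some d) (hβ : β.head? ≠ some d) :
    cutSum m L d α (List.replicate (l + 1) d) β =
      runWeight m L (α ++ List.replicate (l + 1) d ++ β) := by
  rw [cutSum_replicate, runWeight_append_replicate m L α β d l hα hβ, hL d, Finset.mul_sum,
    Finset.mul_sum, Finset.sum_mul]
  refine Finset.sum_congr rfl fun j _ => ?_
  rw [cutWeight, endWeight_mul_runWeight_left m L α d j hα,
    endWeight_mul_runWeight_right m L β d _ hβ, if_pos rfl]
  ring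

lemma cutSum_opposite_run (d : Bool) (α β : List Bool) (l : ℕ)
    (hα : α.getLast? = some d) (hβ : β.head? = some d) :
    cutSum m L d α (List.replicate (l + 1) (!d)) β =
      - runWeight m L (α ++ List.replicate (l + 1) (!d) ++ β) := by
  have hα' : α.getLast? ≠ some (!d) := by simp [hα]
  have hβ' : β.head? ≠ some (!d) := by simp [hβ]
  have hα0 : α ≠ [] := by rintro rfl; simp at hα
  have hβ0 : β ≠ [] := by rintro rfl; simp at hβ
  rw [cutSum_replicate, runWeight_append_replicate m L α β (!d) l hα' hβ', hL (!d), Finset.mul_sum,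
    Finset.mul_sum, Finset.sum_mul, ← Finset.sum_neg_distrib]
  refine Finset.sum_congr rfl fun j _ => ?_
  have hl : endWeight m (!d) (α ++ List.replicate j (!d)) *
      runWeight m L (α ++ List.replicate j (!d)) =
      m (!d) * runWeight m L α * pieceWeight m L d j := by
    rcases j with _ | j
    · simp [pieceWeight, endWeight, hα0]
    · have h := endWeight_mul_runWeight_left m L α (!d) (j + 1) hα'
      have h2 := runWeight_append_replicate m L α [] (!d) j hα' (by simp)
      rw [List.append_nil] at h2
      rw [h2]
      simp [endWeight, runWeight, pieceWeight, hα0]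
      ring
  have hr (i : ℕ) : endWeight m d (List.replicate i (!d) ++ β) *
      runWeight m L (List.replicate i (!d) ++ β) =
      pieceWeight m L (!d) i * (m d * runWeight m L β) := by
    rcases i with _ | i
    · simp [pieceWeight, endWeight, hβ0]
    · rw [runWeight_replicate m L β (!d) i hβ']
      simp [endWeight, pieceWeight, hβ0]
      ring
  rw [cutWeight, hl, hr, if_neg (by simp)]
  simp [endWeight, hα0, hβ0]
  ring

/-- The signed cut contributions over a factor which consists of maximal runs, the first and last
ones having direction `d`, add up to the run weight. -/
lemma cutSum_eq (d : Bool) (α γ β : List Bool) (hα : α.getLast? ≠ some d)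
    (hβ : β.head? ≠ some d) (hh : γ.head? = some d) (hl : γ.getLast? = some d) :
    cutSum m L d α γ β = runWeight m L (α ++ γ ++ β) := by
  induction hn : γ.length using Nat.strong_induction_on generalizing α γ with
  | _ n ih =>
  obtain ⟨k, δ, rfl, hδ⟩ := exists_replicate_append d γ
  rcases k with _ | k
  · simp only [List.replicate_zero, List.nil_append] at hh
    exact absurd hh hδ
  obtain ⟨j, ε, rfl, hε⟩ := exists_replicate_append (!d) δ
  rcases j with _ | j
  · rcases ε with _ | ⟨e, ε⟩
    · simpa using cutSum_run m L hL d α β k hα hβ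
    · simp only [List.replicate_zero, List.nil_append, List.head?_cons, ne_eq,
        Option.some.injEq] at hδ hε
      revert hδ hε; cases e <;> cases d <;> simp
  have hε0 : ε ≠ [] := by
    rintro rfl
    rw [List.append_nil, List.getLast?_append_of_ne_nil _ (by simp)] at hl
    simp [List.getLast?_replicate] at hl
  have hεh : ε.head? = some d := by
    rcases ε with _ | ⟨e, ε⟩
    · exact absurd rfl hε0
    · simp only [List.head?_cons, ne_eq, Option.some.injEq] at hε ⊢
      revert hε; cases e <;> cases d <;> simp
  have hεl : ε.getLast? = some d := by
    rw [← hl, List.getLast?_append_of_ne_nil _ (by simp), List.getLast?_append_of_ne_nil _ hε0]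
  rw [cutSum_append, cutSum_append, cutSum_run m L hL d α _ k hα
      (by simp [List.replicate_succ]),
    cutSum_opposite_run m L hL d _ _ j (by simp [List.getLast?_replicate]) (by simp [hεh]),
    ih ε.length (by rw [← hn]; simp only [List.length_append, List.length_replicate]; omega) _ ε (by
      rw [List.getLast?_append_of_ne_nil _ (by simp)]; simp [List.getLast?_replicate]) hεh hεl rfl]
  simp

end RunWeight

section CutIndex

variable {R : Type*} [CommRing R] (m : Bool → R) (L : ℕ → R)

lemma cutSum_take_drop (d : Bool) (ε : List Bool) (r s : ℕ) (h : s + r ≤ ε.length) :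
    cutSum m L d (ε.take s) ((ε.drop s).take r) (ε.drop (s + r)) =
      ∑ e ∈ Finset.Ico s (s + r), (if ε[e]? = some d then 1 else -1) *
        cutWeight m L d (ε.take e) (ε.drop (e + 1)) := by
  induction r generalizing s with
  | zero => simp [cutSum]
  | succ r ih =>
    have hs : s < ε.length := by omega
    have := ih (s + 1) (by omega)
    rw [show s + 1 + r = s + (r + 1) by omega] at this
    rw [List.drop_eq_getElem_cons hs, List.take_succ_cons, cutSum, List.take_append_getElem hs,
      this, Finset.sum_eq_sum_Ico_succ_bot (show s < s + (r + 1) by omega), List.getElem?_eq_getElem hs,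
      show ε.drop (s + (r + 1)) = (ε.drop (s + 1)).drop r by rw [List.drop_drop]; congr 1; omega,
      List.take_append_drop]
    simp

lemma sum_cutWeight_eq (hL : ∀ d n, L (n + 1) =
      ∑ j ∈ Finset.range (n + 1), pieceWeight m L (!d) j * pieceWeight m L d (n - j))
    (d : Bool) (ε : List Bool) (s t : ℕ) (hst : s < t) (ht : t ≤ ε.length)
    (hs0 : ε[s]? = some d) (hs1 : ∀ i, i + 1 = s → ε[i]? ≠ some d)
    (ht0 : ε[t]? ≠ some d) (ht1 : ε[t - 1]? = some d) :
    ∑ e ∈ Finset.Ico s t, (if ε[e]? = some d then 1 else -1) *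
      cutWeight m L d (ε.take e) (ε.drop (e + 1)) = runWeight m L ε := by
  obtain ⟨r, rfl⟩ := Nat.exists_eq_add_of_lt hst
  rw [show s + r + 1 = s + (r + 1) by omega] at *
  rw [← cutSum_take_drop m L d ε (r + 1) s ht, cutSum_eq m L hL d]
  · rw [List.append_assoc, ← List.drop_drop, List.take_append_drop, List.take_append_drop]
  · rcases s with _ | s
    · simp
    · rw [List.getLast?_eq_getElem?, List.length_take, min_eq_left (by omega), Nat.add_sub_cancel,
        List.getElem?_take_of_lt (by omega)]
      exact hs1 s rfl
  · rwa [List.head?_drop]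
  · rw [List.head?_take, if_neg (by omega), List.head?_drop, hs0]
  · rw [List.getLast?_eq_getElem?, List.length_take, List.length_drop, min_eq_left (by omega),
      Nat.add_sub_cancel, List.getElem?_take_of_lt (by omega), List.getElem?_drop]
    exact ht1

/-- The sign `(-1)` to the number of descents. -/
def descentSign (ε : List Bool) : R := (ε.map fun e => if e then 1 else -1).prod

lemma descentSign_take_mul_drop (d : Bool) (ε : List Bool) (e : ℕ) (he : e < ε.length) :
    (descentSign (ε.take e) * descentSign (ε.drop (e + 1)) : R) =
      (if d then 1 else -1) * descentSign ε * (if ε[e]? = some d then 1 else -1) := by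
  have h : (descentSign ε : R) = descentSign (ε.take e) *
      ((if ε[e] then 1 else -1) * descentSign (ε.drop (e + 1))) := by
    conv_lhs => rw [← List.take_append_drop e ε, List.drop_eq_getElem_cons he]
    simp only [descentSign, List.map_append, List.map_cons, List.prod_append, List.prod_cons]
  rw [h, List.getElem?_eq_getElem he]
  cases ε[e] <;> cases d <;> simp

end CutIndex

/-- The list of ascents (`true`) and non-ascents (`false`) of a word. -/
def ascentWord (w : List ℕ) : List Bool := List.zipWith (fun x y => decide (x < y)) w w.tail

lemma length_ascentWord (w : List ℕ) : (ascentWord w).length = w.length - 1 := by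
  simp [ascentWord]

lemma getElem?_ascentWord (w : List ℕ) (i : ℕ) (h : i + 1 < w.length) :
    (ascentWord w)[i]? = some (decide (w[i] < w[i + 1])) := by
  rw [List.getElem?_eq_getElem (by rw [length_ascentWord]; omega)]
  simp [ascentWord]

lemma ascentWord_take (w : List ℕ) (k : ℕ) :
    ascentWord (w.take k) = (ascentWord w).take (k - 1) := by
  rw [ascentWord, ascentWord, List.take_zipWith]
  apply List.ext_getElem
  · simp; omega
  · intro i h1 h2
    simp

lemma ascentWord_drop (w : List ℕ) (k : ℕ) :
    ascentWord (w.drop k) = (ascentWord w).drop k := by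
  rw [ascentWord, ascentWord, List.drop_zipWith]
  simp [← List.drop_one, Nat.add_comm]

lemma ascentWord_map (w : List ℕ) (f : ℕ → ℕ) (h : ∀ x ∈ w, ∀ y ∈ w, f x < f y ↔ x < y) :
    ascentWord (w.map f) = ascentWord w := by
  apply List.ext_getElem
  · simp [length_ascentWord]
  · intro i h1 h2
    rw [length_ascentWord] at h2
    simp [ascentWord, h]

/-- The words of permutations of `{1, …, n}`. -/
def IsPermWord (w : List ℕ) : Prop := w.Nodup ∧ ∀ x ∈ w, 1 ≤ x ∧ x ≤ w.length

lemma IsPermWord.mem {w : List ℕ} (hw : IsPermWord w) {x : ℕ} (h1 : 1 ≤ x) (h2 : x ≤ w.length) :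
    x ∈ w := by
  have hsub : w.toFinset ⊆ Finset.Icc 1 w.length := by
    intro y hy
    simpa using hw.2 y (List.mem_toFinset.1 hy)
  have := Finset.eq_of_subset_of_card_le hsub
    (by rw [List.toFinset_card_of_nodup hw.1, Nat.card_Icc]; omega)
  rw [← List.mem_toFinset, this, Finset.mem_Icc]
  exact ⟨h1, h2⟩

lemma rank_lt_rank {w : List ℕ} {x y : ℕ} (hy : y ∈ w) (h : x < y) :
    (w.filter (· ≤ x)).length < (w.filter (· ≤ y)).length := by
  have hs : (w.filter (· ≤ x)).Sublist (w.filter (· ≤ y)) :=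
    List.monotone_filter_right w fun a ha => by
      simp only [decide_eq_true_eq] at ha ⊢; omega
  refine lt_of_le_of_ne hs.length_le fun he => ?_
  have hm : y ∈ w.filter (· ≤ y) := by simp [hy]
  rw [← hs.eq_of_length he] at hm
  simp only [List.mem_filter, decide_eq_true_eq] at hm
  omega

lemma rank_lt_rank_iff {w : List ℕ} {x y : ℕ} (hx : x ∈ w) (hy : y ∈ w) :
    (w.filter (· ≤ x)).length < (w.filter (· ≤ y)).length ↔ x < y := by
  refine ⟨fun h => ?_, rank_lt_rank hy⟩
  by_contra hxy
  rcases (not_lt.1 hxy).eq_or_lt with rfl | h'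
  · exact lt_irrefl _ h
  · exact lt_asymm h (rank_lt_rank hx h')

lemma length_stdW (w : List ℕ) : (stdW w).length = w.length := by simp [stdW]

lemma ascentWord_stdW (w : List ℕ) : ascentWord (stdW w) = ascentWord w :=
  ascentWord_map w _ fun _ hx _ hy => rank_lt_rank_iff hx hy

lemma isPermWord_stdW {w : List ℕ} (hw : w.Nodup) : IsPermWord (stdW w) := by
  constructor
  · refine hw.map_on fun x hx y hy h => ?_
    rcases lt_trichotomy x y with h' | h' | h'
    · exact absurd h (rank_lt_rank hy h').ne
    · exact h'
    · exact absurd h (rank_lt_rank hx h').ne'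
  · intro z hz
    obtain ⟨x, hx, rfl⟩ := List.mem_map.1 hz
    rw [length_stdW]
    refine ⟨List.length_pos_of_mem (a := x) (by simp [hx]), List.length_filter_le _ _⟩

lemma mem_take_iff_idxOf {w : List ℕ} {x : ℕ} (hx : x ∈ w) (k : ℕ) :
    x ∈ w.take k ↔ w.idxOf x < k := by
  constructor
  · intro h
    rw [← List.take_append_drop k w, List.idxOf_append_of_mem h]
    have := List.idxOf_lt_length_iff.2 h
    rw [List.length_take] at this
    omega
  · intro h
    have hl := List.idxOf_lt_length_iff.2 hx
    rw [List.mem_take_iff_getElem]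
    exact ⟨w.idxOf x, by omega, List.getElem_idxOf hl⟩

lemma mem_drop_iff_idxOf {w : List ℕ} (hw : w.Nodup) {x : ℕ} (hx : x ∈ w) (k : ℕ) :
    x ∈ w.drop k ↔ k ≤ w.idxOf x := by
  rw [← not_lt, ← mem_take_iff_idxOf hx]
  have hd := List.disjoint_take_drop hw (le_refl k)
  have hm : x ∈ w.take k ∨ x ∈ w.drop k := by
    rw [← List.mem_append, List.take_append_drop]; exact hx
  exact ⟨fun h h' => hd h' h, fun h => hm.resolve_left h⟩

/-- The variable attached to ascending (`true`) and descending (`false`) runs. -/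
noncomputable def runVar (d : Bool) : MvPolynomial (Fin 2) ℤ := if d then X 0 else X 1

lemma caP_succ_s4 (d : Bool) (n : ℕ) : caP (n + 1) =
    ∑ j ∈ Finset.range (n + 1), pieceWeight runVar caP (!d) j * pieceWeight runVar caP d (n - j) := by
  have h : caP (n + 1) = ∑ j ∈ Finset.range (n + 1),
      pieceWeight runVar caP true j * pieceWeight runVar caP false (n - j) := by
    rw [caP_eq_quadCoeff, quadCoeff, Finset.sum_range]
    simp [pieceWeight, runVar, caP_eq_quadCoeff]
  cases d
  · exact h
  · rw [h, ← Finset.sum_range_reflect]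
    refine Finset.sum_congr rfl fun j hj => ?_
    have := Finset.mem_range.1 hj
    rw [mul_comm, show n - (n + 1 - 1 - j) = j by omega, show n + 1 - 1 - j = n - j by omega]
    rfl

lemma sum_cuts_eq (d : Bool) (w : List ℕ) (f : ℕ) (s t : ℕ) (hw : IsPermWord w)
    (hf : w.length ≤ f + 1)
    (ih : ∀ v : List ℕ, IsPermWord v → v.length ≤ f →
      cAux f v = descentSign (ascentWord v) * runWeight runVar caP (ascentWord v))
    (hst : s < t) (ht : t < w.length)
    (hs0 : (ascentWord w)[s]? = some d) (hs1 : ∀ i, i + 1 = s → (ascentWord w)[i]? ≠ some d)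
    (ht0 : (ascentWord w)[t]? ≠ some d) (ht1 : (ascentWord w)[t - 1]? = some d) :
    ∑ k ∈ Finset.Ioo 0 w.length, (if s < k ∧ k ≤ t then
      (if 2 ≤ k then runVar (!d) else 1) * (if 2 ≤ w.length - k then runVar d else 1) *
        cAux f (stdW (w.take k)) * cAux f (stdW (w.drop k)) else 0) =
      (if d then 1 else -1) *
        (descentSign (ascentWord w) * runWeight runVar caP (ascentWord w)) := by
  have hlen := length_ascentWord w
  rw [← sum_cutWeight_eq runVar caP caP_succ_s4 d (ascentWord w) s t hst (by omega) hs0 hs1 ht0 ht1,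
    ← Finset.sum_filter, ← mul_assoc, Finset.mul_sum]
  symm
  refine Finset.sum_bij (fun e _ => e + 1) ?_ ?_ ?_ ?_
  · intro e he
    simp only [Finset.mem_Ico, Finset.mem_filter, Finset.mem_Ioo] at he ⊢
    omega
  · intro _ _ _ _ h
    omega
  · intro k hk
    simp only [Finset.mem_filter, Finset.mem_Ioo] at hk
    exact ⟨k - 1, by simp only [Finset.mem_Ico]; omega, by omega⟩
  · intro e he
    rw [Finset.mem_Ico] at he
    rw [← mul_assoc, ← descentSign_take_mul_drop d (ascentWord w) e (by omega),
      ih _ (isPermWord_stdW (hw.1.sublist (List.take_sublist _ _)))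
        (by rw [length_stdW, List.length_take]; omega),
      ih _ (isPermWord_stdW (hw.1.sublist (List.drop_sublist _ _)))
        (by rw [length_stdW, List.length_drop]; omega),
      ascentWord_stdW, ascentWord_stdW, ascentWord_take, ascentWord_drop, Nat.add_sub_cancel,
      cutWeight]
    have h1 : endWeight runVar (!d) ((ascentWord w).take e) =
        if 2 ≤ e + 1 then runVar (!d) else 1 := by
      rw [endWeight]
      have : (ascentWord w).take e = [] ↔ ¬ 2 ≤ e + 1 := by
        rw [← List.length_eq_zero_iff, List.length_take]; omega
      simp only [this, ite_not]
    have h2 : endWeight runVar d ((ascentWord w).drop (e + 1)) =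
        if 2 ≤ w.length - (e + 1) then runVar d else 1 := by
      rw [endWeight]
      have : (ascentWord w).drop (e + 1) = [] ↔ ¬ 2 ≤ w.length - (e + 1) := by
        rw [← List.length_eq_zero_iff, List.length_drop]; omega
      simp only [this, ite_not]
    rw [h1, h2]
    ring

lemma ascentWord_ne_min {w : List ℕ} (hw : IsPermWord w) {s : ℕ} (hs : s < w.length)
    (h : w[s] = 1) : (ascentWord w)[s]? ≠ some false ∧
      ∀ i, i + 1 = s → (ascentWord w)[i]? ≠ some true := by
  constructor
  · by_cases hs' : s + 1 < w.length
    · rw [getElem?_ascentWord w s hs']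
      have h1 := (hw.2 _ (List.getElem_mem hs')).1
      have h2 : w[s] ≠ w[s + 1] := fun h => by
        have := (hw.1.getElem_inj_iff).1 h; omega
      simp; omega
    · rw [List.getElem?_eq_none (by rw [length_ascentWord]; omega)]
      simp
  · rintro i rfl
    rw [getElem?_ascentWord w i hs]
    have h1 := (hw.2 _ (List.getElem_mem (show i < w.length by omega))).1
    simp; omega

lemma ascentWord_ne_max {w : List ℕ} (hw : IsPermWord w) {t : ℕ} (ht : t < w.length)
    (h : w[t] = w.length) : (ascentWord w)[t]? ≠ some true ∧
      ∀ i, i + 1 = t → (ascentWord w)[i]? ≠ some false := by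
  constructor
  · by_cases ht' : t + 1 < w.length
    · rw [getElem?_ascentWord w t ht']
      have h1 := (hw.2 _ (List.getElem_mem ht')).2
      simp; omega
    · rw [List.getElem?_eq_none (by rw [length_ascentWord]; omega)]
      simp
  · rintro i rfl
    rw [getElem?_ascentWord w i ht]
    have h1 := (hw.2 _ (List.getElem_mem (show i < w.length by omega))).2
    have h2 : w[i] ≠ w[i + 1] := fun h => by
      have := (hw.1.getElem_inj_iff).1 h; omega
    simp; omega

lemma getElem?_ascentWord_of_ne {w : List ℕ} {i : ℕ} (d : Bool) (h : i + 1 < w.length)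
    (hne : (ascentWord w)[i]? ≠ some (!d)) : (ascentWord w)[i]? = some d := by
  rw [getElem?_ascentWord w i h] at hne ⊢
  revert hne
  cases decide (w[i] < w[i + 1]) <;> cases d <;> simp

lemma cAux_eq (f : ℕ) (w : List ℕ) (hw : IsPermWord w) (hf : w.length ≤ f) :
    cAux f w = descentSign (ascentWord w) * runWeight runVar caP (ascentWord w) := by
  induction f generalizing w with
  | zero =>
    have : ascentWord w = [] := by
      rw [← List.length_eq_zero_iff, length_ascentWord]; omega
    simp [cAux, this, descentSign, runWeight]
  | succ f ih =>
    rw [cAux]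
    split_ifs with hlen
    · have : ascentWord w = [] := by
        rw [← List.length_eq_zero_iff, length_ascentWord]; omega
      simp [this, descentSign, runWeight]
    have h1 : 1 ∈ w := hw.mem le_rfl (by omega)
    have hn : w.length ∈ w := hw.mem (by omega) le_rfl
    simp only [mem_take_iff_idxOf h1, mem_take_iff_idxOf hn, mem_drop_iff_idxOf hw.1 h1,
      mem_drop_iff_idxOf hw.1 hn]
    have hs := List.idxOf_lt_length_iff.2 h1
    have ht := List.idxOf_lt_length_iff.2 hn
    have hws : w[w.idxOf 1] = 1 := List.getElem_idxOf hs
    have hwt : w[w.idxOf w.length] = w.length := List.getElem_idxOf ht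
    obtain ⟨hs0, hs1⟩ := ascentWord_ne_min hw hs hws
    obtain ⟨ht0, ht1⟩ := ascentWord_ne_max hw ht hwt
    generalize w.idxOf 1 = s at *
    generalize w.idxOf w.length = t at *
    have hst : s ≠ t := by
      rintro rfl
      omega
    rcases lt_or_gt_of_ne hst with hlt | hlt
    · rw [Finset.sum_eq_zero (s := Finset.Ioo 0 w.length)
        (f := fun k => if t < k ∧ k ≤ s then _ else _)
        (fun k _ => if_neg (by omega)), sub_zero]
      have := sum_cuts_eq true w f s t hw hf ih hlt ht
        (getElem?_ascentWord_of_ne true (by omega) hs0) hs1 ht0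
        (getElem?_ascentWord_of_ne true (by omega) (ht1 _ (by omega)))
      simp only [runVar, Bool.not_true, Bool.false_eq_true, if_true, if_false, one_mul] at this
      exact this
    · rw [Finset.sum_eq_zero (s := Finset.Ioo 0 w.length)
        (f := fun k => if s < k ∧ k ≤ t then _ else _)
        (fun k _ => if_neg (by omega)), zero_sub]
      have := sum_cuts_eq false w f t s hw hf ih hlt hs
        (getElem?_ascentWord_of_ne false (by omega) ht0) ht1 hs0
        (getElem?_ascentWord_of_ne false (by omega) (hs1 _ (by omega)))
      rw [neg_eq_iff_eq_neg]
      simp only [runVar, Bool.not_false, Bool.false_eq_true, if_true, if_false,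
        neg_one_mul] at this
      exact this

lemma isPermWord_permWord {n : ℕ} (σ : Equiv.Perm (Fin n)) : IsPermWord (permWord σ) := by
  constructor
  · rw [permWord, List.nodup_ofFn]
    intro i j h
    simpa [Fin.val_inj] using h
  · intro x hx
    rw [permWord, List.mem_ofFn] at hx
    obtain ⟨i, rfl⟩ := hx
    simp [permWord]

lemma neg_one_pow_card_desSet {w : List ℕ} (hw : w.Nodup) :
    ((-1) ^ (desSet w).card : MvPolynomial (Fin 2) ℤ) = descentSign (ascentWord w) := by
  have hd : (descentSign (ascentWord w) : MvPolynomial (Fin 2) ℤ) =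
      ∏ i ∈ Finset.range (w.length - 1), if w.getD (i + 1) 0 < w.getD i 0 then -1 else 1 := by
    rw [descentSign, ← length_ascentWord, Finset.prod_range, ← List.prod_ofFn]
    congr 1
    apply List.ext_getElem
    · simp
    · intro i h1 h2
      have hi : i + 1 < w.length := by
        rw [List.length_map, length_ascentWord] at h1; omega
      have hne : w[i] ≠ w[i + 1] := fun h => by
        have := (hw.getElem_inj_iff).1 h; omega
      have hwi : w.getD i 0 = w[i] := List.getD_eq_getElem _ _ _
      have hwi' : w.getD (i + 1) 0 = w[i + 1] := List.getD_eq_getElem _ _ _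
      simp only [List.getElem_map, List.getElem_ofFn, hwi, hwi', ascentWord, List.getElem_zipWith,
        List.getElem_tail, decide_eq_true_eq]
      split_ifs <;> first | rfl | omega
  rw [hd, desSet, ← Finset.prod_const, Finset.prod_filter, Finset.range_eq_Ico]
  exact (Finset.prod_Ico_add' (fun i => if w.getD i 0 < w.getD (i - 1) 0 then
    (-1 : MvPolynomial (Fin 2) ℤ) else 1) 0 (w.length - 1) 1).symm

lemma lt_of_forall_lt_succ (i : ℕ → ℕ) (p : ℕ) (h : ∀ k ≤ p, i k < i (k + 1)) :
    i 0 < i (p + 1) := by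
  induction p with
  | zero => exact h 0 le_rfl
  | succ p ih => exact (ih fun k hk => h k (by omega)).trans (h (p + 1) le_rfl)

lemma ascentWord_of_incOn {w : List ℕ} {l r e : ℕ} (h : incOn w l r) (hr : r ≤ w.length)
    (he : l ≤ e + 1) (her : e + 1 < r) : (ascentWord w)[e]? = some true := by
  have := h (e + 1) he her
  simp only [get1, Nat.add_sub_cancel] at this
  rw [List.getD_eq_getElem _ _ (by omega), List.getD_eq_getElem _ _ (by omega)] at this
  rw [getElem?_ascentWord w e (by omega)]
  simpa using this

lemma ascentWord_of_decOn {w : List ℕ} {l r e : ℕ} (h : decOn w l r) (hr : r ≤ w.length)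
    (he : l ≤ e + 1) (her : e + 1 < r) : (ascentWord w)[e]? = some false := by
  have := h (e + 1) he her
  simp only [get1, Nat.add_sub_cancel] at this
  rw [List.getD_eq_getElem _ _ (by omega), List.getD_eq_getElem _ _ (by omega)] at this
  rw [getElem?_ascentWord w e (by omega)]
  simp
  omega

open scoped Classical in
lemma ascentWord_of_monoOn {w : List ℕ} {l r e : ℕ} (h : monoOn w l r) (hr : r ≤ w.length)
    (he : l ≤ e + 1) (her : e + 1 < r) :
    (ascentWord w)[e]? = some (decide (incOn w l r)) := by
  by_cases hi : incOn w l r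
  · simpa [hi] using ascentWord_of_incOn hi hr he her
  · simpa [hi] using ascentWord_of_decOn (h.resolve_left hi) hr he her

open scoped Classical in
lemma decide_incOn_ne {w : List ℕ} {l c r : ℕ} (h1 : monoOn w l c) (h2 : monoOn w c r)
    (h : ¬ monoOn w l r) : decide (incOn w c r) ≠ decide (incOn w l c) := by
  intro he
  rw [decide_eq_decide] at he
  apply h
  by_cases hi : incOn w l c
  · refine Or.inl fun j hj hjr => ?_
    rcases lt_or_ge j c with hc | hc
    · exact hi j hj hc
    · exact he.2 hi j hc hjr
  · refine Or.inr fun j hj hjr => ?_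
    rcases lt_or_ge j c with hc | hc
    · exact h1.resolve_left hi j hj hc
    · exact h2.resolve_left (fun h' => hi (he.1 h')) j hc hjr

open scoped Classical in
lemma drop_ascentWord_of_monoOn {w : List ℕ} {l r : ℕ} (h : monoOn w l r) (hl : 1 ≤ l)
    (hlr : l ≤ r) (hr : r ≤ w.length) :
    (ascentWord w).drop (l - 1) =
      List.replicate (r - l) (decide (incOn w l r)) ++ (ascentWord w).drop (r - 1) := by
  have : r - 1 = l - 1 + (r - l) := by omega
  rw [this, ← List.drop_drop, eq_comm]
  conv_rhs => rw [← List.take_append_drop (r - l) ((ascentWord w).drop (l - 1))]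
  congr 1
  rw [eq_comm, List.eq_replicate_iff]
  refine ⟨by simp [length_ascentWord]; omega, fun b hb => ?_⟩
  obtain ⟨i, hi, rfl⟩ := List.mem_iff_getElem.1 hb
  have hi' : i < r - l := by
    rw [List.length_take] at hi; omega
  have := ascentWord_of_monoOn h hr (e := l - 1 + i) (by omega) (by omega)
  rw [← Option.some_inj, ← this, ← List.getElem?_eq_getElem hi, List.getElem?_take_of_lt hi',
    List.getElem?_drop]

open scoped Classical in
lemma runWeight_drop_ascentWord (w : List ℕ) (p : ℕ) (i : ℕ → ℕ) (h0 : 1 ≤ i 0)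
    (hp : i (p + 1) = w.length) (hi : ∀ k, k ≤ p → i k < i (k + 1))
    (hm : ∀ k, k ≤ p → monoOn w (i k) (i (k + 1)))
    (hn : ∀ k, k + 1 ≤ p → ¬ monoOn w (i k) (i (k + 2))) :
    runWeight runVar caP ((ascentWord w).drop (i 0 - 1)) =
      (∏ k ∈ Finset.range p,
          if incOn w (i k) (i (k + 1)) then X 0 else (X 1 : MvPolynomial (Fin 2) ℤ))
        * ∏ k ∈ Finset.range (p + 1), caP (i (k + 1) - i k) := by
  induction p generalizing i with
  | zero =>
    have h01 := hi 0 le_rfl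
    rw [zero_add] at hp h01
    obtain ⟨q, hq⟩ := Nat.exists_eq_add_of_lt h01
    rw [drop_ascentWord_of_monoOn (hm 0 le_rfl) h0 (hi 0 le_rfl).le hp.le, zero_add, hp,
      List.drop_eq_nil_of_le (by rw [length_ascentWord]), ← hp,
      show i 1 - i 0 = q + 1 by omega, runWeight_replicate _ _ _ _ _ (by simp)]
    simp [endWeight, runWeight, show i 1 - i 0 = q + 1 by omega]
  | succ p ih =>
    have h01 := hi 0 (by omega)
    have h12 : i 1 < i 2 := hi 1 (by omega)
    have h2n : i 2 ≤ w.length := by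
      rcases p with _ | p
      · exact hp.le
      · have := lt_of_forall_lt_succ (fun k => i (k + 2)) p fun k hk => hi (k + 2) (by omega)
        simp only [zero_add] at this
        rw [← hp]
        exact this.le
    have hrec := ih (fun k => i (k + 1)) (by simp only [zero_add] at h01 ⊢; omega) hp
      (fun k hk => hi (k + 1) (by omega)) (fun k hk => hm (k + 1) (by omega))
      (fun k hk => hn (k + 1) (by omega))
    simp only [zero_add] at hrec h01
    obtain ⟨q, hq⟩ := Nat.exists_eq_add_of_lt h01
    have hhead : ((ascentWord w).drop (i 1 - 1)).head? = some (decide (incOn w (i 1) (i 2))) := by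
      rw [List.head?_drop]
      exact ascentWord_of_monoOn (hm 1 (by omega)) h2n (by omega) (by omega)
    have hne := decide_incOn_ne (hm 0 (by omega)) (hm 1 (by omega)) (hn 0 (by omega))
    simp only [zero_add, Nat.reduceAdd] at hne
    have hnil : (ascentWord w).drop (i 1 - 1) ≠ [] := by
      intro h; simp [h] at hhead
    have hdrop := drop_ascentWord_of_monoOn (hm 0 (by omega)) h0 (hi 0 (by omega)).le
      (by simp only [zero_add]; omega)
    simp only [zero_add] at hdrop
    have hq' : i 1 - i 0 = q + 1 := by omega
    rw [hdrop, hq', runWeight_replicate _ _ _ _ _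
        (by rw [hhead]; simpa using hne), hrec, endWeight, if_neg hnil,
      Finset.prod_range_succ' (fun k => if incOn w (i k) (i (k + 1)) then X 0 else X 1) p,
      Finset.prod_range_succ' (fun k => caP (i (k + 1) - i k)) (p + 1)]
    simp only [runVar, decide_eq_true_eq, zero_add, hq']
    ring

open scoped Classical in
theorem stmt4 : ∀ n : ℕ, 2 ≤ n → ∀ σ : Equiv.Perm (Fin n), ∀ p : ℕ, ∀ i : ℕ → ℕ,
    i 0 = 1 → i (p + 1) = n →
    (∀ k, k ≤ p → i k < i (k + 1)) →
    (∀ k, k ≤ p → monoOn (permWord σ) (i k) (i (k + 1))) →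
    (∀ k, k + 1 ≤ p → ¬ monoOn (permWord σ) (i k) (i (k + 2))) →
    cpol (permWord σ) =
      (-1) ^ (desSet (permWord σ)).card
        * (∏ k ∈ Finset.range p,
            if incOn (permWord σ) (i k) (i (k + 1)) then X 0 else (X 1 : MvPolynomial (Fin 2) ℤ))
        * ∏ k ∈ Finset.range (p + 1), caP (i (k + 1) - i k) := by
  intro n hn σ p i h0 hp hi hm hnm
  have hw := isPermWord_permWord σ
  have hlen : (permWord σ).length = n := by simp [permWord]
  have h := runWeight_drop_ascentWord (permWord σ) p i h0.ge (hp.trans hlen.symm) hi hm hnm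
  rw [h0, Nat.sub_self, List.drop_zero] at h
  rw [cpol, cAux_eq _ _ hw le_rfl, h, neg_one_pow_card_desSet hw.1, mul_assoc]
end
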